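/- arXiv:2507.04016 — 2 statements merged into one kernel-verified Lean document; each statement's English description precedes it below -/
import Mathlib

section
/- For all integers m, K ≥ 1, there exists a deterministic online algorithm for OMSS(m,K) that is (K+1)-competitive. -/
open Finset

/-- An instance of Online Makespan Scheduling under Scenarios with `K` scenarios:
`n` jobs `1,…,n`, nonnegative processing times `p`, and scenarios `S k ⊆ {1,…,n}`. -/
structure OMSSInstance (K : ℕ) where
  n : ℕ
  p : ℕ → ℝ
  hp : ∀ j, 0 ≤ p j
  S : Fin K → Finset ℕ
  hS : ∀ k, S k ⊆ Finset.Icc 1 n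

/-- A deterministic online algorithm for `OMSS(m,K)`: the machine for job `j` is a
function only of `j`, the processing times revealed so far, and the partial scenarios. -/
abbrev OnlineAlg (m K : ℕ) := ℕ → (ℕ → ℝ) → (Fin K → Finset ℕ) → Fin m

/-- The assignment produced by online algorithm `A` on instance `I`:
for job `j` the algorithm only sees `p_1,…,p_j` and `S_k ∩ [j]`. -/
noncomputable def algAssign {m K : ℕ} (A : OnlineAlg m K) (I : OMSSInstance K) : ℕ → Fin m :=
  fun j => A j (fun j' => if j' ≤ j then I.p j' else 0) (fun k => I.S k ∩ Finset.Icc 1 j)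

/-- Load of machine `i` in scenario `k` under assignment `τ`. -/
noncomputable def load {m K : ℕ} (I : OMSSInstance K) (τ : ℕ → Fin m) (i : Fin m)
    (k : Fin K) : ℝ :=
  ∑ j ∈ (I.S k).filter (fun j => τ j = i), I.p j

/-- Makespan of an assignment: the largest load of a machine in a scenario. -/
noncomputable def mkspan {m K : ℕ} (I : OMSSInstance K) (τ : ℕ → Fin m) : ℝ :=
  sSup {x | ∃ k : Fin K, ∃ i : Fin m, x = load I τ i k}

/-- Offline optimum makespan over all assignments to `m` machines. -/
noncomputable def OPT (m : ℕ) {K : ℕ} (I : OMSSInstance K) : ℝ :=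
  sInf {x | ∃ τ : ℕ → Fin m, x = mkspan I τ}

/-- Machine `i` is at most `K` times as loaded as the average machine, in every scenario. -/
def IsBalancedMachine {m K : ℕ} (L : Fin m → Fin K → ℝ) (i : Fin m) : Prop :=
  ∀ k, (m : ℝ) * L i k ≤ K * ∑ i', L i' k

theorem exists_balanced {m K : ℕ} (hm : 0 < m) (hK : 0 < K) (L : Fin m → Fin K → ℝ)
    (hL : ∀ i k, 0 ≤ L i k) : ∃ i, IsBalancedMachine L i := by
  by_contra! h
  simp only [IsBalancedMachine, not_forall, not_le] at h
  choose f hf using h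
  have : NeZero K := ⟨hK.ne'⟩
  obtain ⟨k, -, hk⟩ : ∃ k ∈ (univ : Finset (Fin K)),
      ((univ : Finset (Fin m)).card : ℝ) / K ≤ (#{i | f i = k} : ℝ) := by
    apply Finset.exists_le_card_fiber_of_nsmul_le_card_of_maps_to
    · simp
    · simp
    · simp [mul_div_cancel₀, hK.ne']
  have hK' : (0 : ℝ) < K := by exact_mod_cast hK
  have hm' : (0 : ℝ) < m := by exact_mod_cast hm
  rw [card_fin, div_le_iff₀ hK'] at hk
  have hne : ({i | f i = k} : Finset (Fin m)).Nonempty := by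
    rw [← card_pos]
    by_contra! h0
    have h0 : #{i | f i = k} = 0 := by omega
    rw [h0] at hk
    simp only [Nat.cast_zero, zero_mul] at hk
    linarith
  have hT : 0 ≤ ∑ i, L i k := sum_nonneg fun i _ => hL i k
  have h₁ : ∑ i with f i = k, K * ∑ i', L i' k < ∑ i with f i = k, (m : ℝ) * L i k := by
    refine sum_lt_sum_of_nonempty hne fun i hi => ?_
    obtain rfl := (mem_filter.1 hi).2
    exact hf i
  have h₂ : ∑ i with f i = k, L i k ≤ ∑ i, L i k :=
    sum_le_sum_of_subset_of_nonneg (filter_subset _ _) fun i _ _ => hL i k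
  rw [← mul_sum, ← mul_sum, sum_const, nsmul_eq_mul] at h₁
  nlinarith [mul_le_mul_of_nonneg_left h₂ hm'.le, mul_le_mul_of_nonneg_right hk hT]

/-- Some balanced machine, if there is one. -/
noncomputable def balancedMachine {m K : ℕ} [NeZero m] (L : Fin m → Fin K → ℝ) : Fin m :=
  Classical.epsilon (IsBalancedMachine L)

/-- The loads after scheduling all jobs before `j`, each on a balanced machine. -/
noncomputable def greedyLoad {m K : ℕ} [NeZero m] (p : ℕ → ℝ) (S : Fin K → Finset ℕ) :
    ℕ → Fin m → Fin K → ℝ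
  | 0 => 0
  | j + 1 => fun i k => greedyLoad p S j i k +
      if balancedMachine (greedyLoad p S j) = i ∧ j ∈ S k then p j else 0

/-- The online algorithm scheduling every job on a balanced machine. -/
noncomputable def greedyAlg (m K : ℕ) [NeZero m] : OnlineAlg m K :=
  fun j p S => balancedMachine (greedyLoad p S j)

section Greedy

variable {m K : ℕ} [NeZero m]

theorem greedyLoad_congr {p q : ℕ → ℝ} {S T : Fin K → Finset ℕ} {j : ℕ}
    (hp : ∀ l < j, p l = q l) (hS : ∀ l < j, ∀ k, l ∈ S k ↔ l ∈ T k) :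
    (greedyLoad p S j : Fin m → Fin K → ℝ) = greedyLoad q T j := by
  induction j with
  | zero => rfl
  | succ j ih =>
    have h := ih (fun l hl => hp l (by omega)) (fun l hl => hS l (by omega))
    funext i k
    simp only [greedyLoad, h, hp j (by omega), hS j (by omega) k]

theorem algAssign_greedyAlg (I : OMSSInstance K) (j : ℕ) :
    algAssign (greedyAlg m K) I j = balancedMachine (greedyLoad I.p I.S j) := by
  unfold algAssign greedyAlg
  rw [greedyLoad_congr (q := I.p) (T := I.S)]
  · intro l hl
    simp [hl.le]
  · intro l hl k
    simp only [mem_inter, mem_Icc, and_iff_left_iff_imp]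
    exact fun h => ⟨(mem_Icc.1 (I.hS k h)).1, hl.le⟩

theorem greedyLoad_nonneg {p : ℕ → ℝ} (hp : ∀ j, 0 ≤ p j) (S : Fin K → Finset ℕ) (j : ℕ)
    (i : Fin m) (k : Fin K) : 0 ≤ greedyLoad p S j i k := by
  induction j with
  | zero => exact le_rfl
  | succ j ih =>
    have := hp j
    simp only [greedyLoad]
    positivity

theorem greedyLoad_eq_sum (I : OMSSInstance K) (j : ℕ) (i : Fin m) (k : Fin K) :
    greedyLoad I.p I.S j i k =
      ∑ l ∈ range j, if algAssign (greedyAlg m K) I l = i ∧ l ∈ I.S k then I.p l else 0 := by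
  induction j with
  | zero => rfl
  | succ j ih => rw [sum_range_succ, ← ih, algAssign_greedyAlg, greedyLoad]

theorem load_greedyAlg (I : OMSSInstance K) (i : Fin m) (k : Fin K) :
    load I (algAssign (greedyAlg m K) I) i k = greedyLoad I.p I.S (I.n + 1) i k := by
  rw [greedyLoad_eq_sum, load, ← sum_filter]
  congr 1
  ext l
  have := fun h : l ∈ I.S k => mem_Icc.1 (I.hS k h)
  simp only [mem_filter, mem_range]
  grind

theorem sum_greedyLoad_le (I : OMSSInstance K) (j : ℕ) (k : Fin K) :
    ∑ i : Fin m, greedyLoad I.p I.S j i k ≤ ∑ l ∈ I.S k, I.p l := by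
  simp_rw [greedyLoad_eq_sum]
  rw [sum_comm]
  simp_rw [ite_and, sum_ite_eq, mem_univ, if_true]
  rw [← sum_filter]
  refine sum_le_sum_of_subset_of_nonneg (fun l hl => (mem_filter.1 hl).2) fun l _ _ => I.hp l

theorem greedyLoad_le (hK : 0 < K) (I : OMSSInstance K) {M : ℝ} (hM : 0 ≤ M)
    (hjob : ∀ k, ∀ j ∈ I.S k, I.p j ≤ M) (htotal : ∀ k, ∑ j ∈ I.S k, I.p j ≤ m * M)
    (j : ℕ) (i : Fin m) (k : Fin K) :
    greedyLoad I.p I.S j i k ≤ (K + 1) * M := by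
  induction j with
  | zero =>
    simp only [greedyLoad, Pi.zero_apply]
    positivity
  | succ j ih =>
    simp only [greedyLoad]
    split_ifs with h
    · obtain ⟨rfl, hj⟩ := h
      have hbal : IsBalancedMachine (greedyLoad I.p I.S j) (balancedMachine (m := m) _) :=
        Classical.epsilon_spec
          (exists_balanced (Nat.pos_of_neZero m) hK _ (greedyLoad_nonneg I.hp I.S j))
      have hm : (0 : ℝ) < m := by exact_mod_cast Nat.pos_of_neZero m
      have hload := (hbal k).trans (mul_le_mul_of_nonneg_left
        ((sum_greedyLoad_le I j k).trans (htotal k)) K.cast_nonneg)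
      rw [mul_left_comm] at hload
      linarith [le_of_mul_le_mul_left hload hm, hjob k j hj]
    · simpa using ih

end Greedy

section Makespan

variable {m K : ℕ} (I : OMSSInstance K) (τ : ℕ → Fin m)

theorem load_nonneg (i : Fin m) (k : Fin K) : 0 ≤ load I τ i k :=
  sum_nonneg fun j _ => I.hp j

theorem load_le_mkspan (i : Fin m) (k : Fin K) : load I τ i k ≤ mkspan I τ := by
  refine le_csSup (Set.Finite.bddAbove ?_) ⟨k, i, rfl⟩
  refine (Set.finite_range fun x : Fin K × Fin m => load I τ x.2 x.1).subset ?_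
  rintro _ ⟨k, i, rfl⟩
  exact ⟨(k, i), rfl⟩

theorem mkspan_nonneg : 0 ≤ mkspan I τ := by
  refine Real.sSup_nonneg ?_
  rintro _ ⟨k, i, rfl⟩
  exact load_nonneg I τ i k

theorem job_le_mkspan (k : Fin K) {j : ℕ} (hj : j ∈ I.S k) : I.p j ≤ mkspan I τ :=
  (single_le_sum (f := I.p) (fun l _ => I.hp l) (s := {l ∈ I.S k | τ l = τ j})
    (mem_filter.2 ⟨hj, rfl⟩)).trans
    (load_le_mkspan I τ (τ j) k)

theorem total_le_mul_mkspan (k : Fin K) : ∑ j ∈ I.S k, I.p j ≤ m * mkspan I τ := by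
  rw [← sum_fiberwise (I.S k) τ I.p]
  refine (sum_le_sum fun i _ => load_le_mkspan I τ i k).trans ?_
  simp

end Makespan

/-- **Corollary.** For all `m, K ≥ 1` there is a deterministic online algorithm for
`OMSS(m,K)` that is `(K+1)`-competitive. -/
theorem exists_Kplus1_competitive_algorithm (m K : ℕ) (hm : 1 ≤ m) (hK : 1 ≤ K) :
    ∃ A : OnlineAlg m K, ∀ I : OMSSInstance K,
      mkspan I (algAssign A I) ≤ ((K : ℝ) + 1) * OPT m I := by
  have : NeZero m := ⟨by omega⟩
  refine ⟨greedyAlg m K, fun I => ?_⟩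
  have hK' : (0 : ℝ) < K + 1 := by positivity
  rw [← div_le_iff₀' hK']
  refine le_csInf ⟨_, fun _ => 0, rfl⟩ ?_
  rintro _ ⟨τ, rfl⟩
  rw [div_le_iff₀' hK']
  refine Real.sSup_le ?_ (mul_nonneg hK'.le (mkspan_nonneg I τ))
  rintro _ ⟨k, i, rfl⟩
  rw [load_greedyAlg]
  exact greedyLoad_le hK I (mkspan_nonneg I τ) (fun k _ hj => job_le_mkspan I τ k hj)
    (total_le_mul_mkspan I τ) _ i k
end

section
/- Define X(m,d) for integers m,d ≥ 1 by X(m,d) = 1 if m = 1 or d = 1, and X(m,d) = X(m−1,d)·((m−1)·X(m,d−1) + 1) + X(m,d−1) otherwise. Then for all integers m,d ≥ 1 and every deterministic online algorithm A for OMHC(m), there exists a hyperforest instance H with at most X(m,d) nodes such that A's coloring φ of H satisfies at least one of: (i) every color is used, i.e., φ⁻¹(i) ≠ ∅ for all i ∈ [m]; or (ii) some hyperedge e ∈ E with |e| = d is monochromatic under φ. -/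
open Finset

/-- An instance of Online Makespan Hypergraph Coloring: a hypergraph on nodes `{1,…,n}`. -/
structure OMHCInstance where
  n : ℕ
  E : Finset (Finset ℕ)
  hE : ∀ e ∈ E, e ⊆ Finset.Icc 1 n

/-- A deterministic online algorithm for `OMHC(m)`: the color of node `j` is a function
only of `j` and the partial hyperedges `e ∩ [j]`. -/
abbrev OMHCAlg (m : ℕ) := ℕ → Finset (Finset ℕ) → Fin m

/-- The coloring produced by online algorithm `A` on instance `I`. -/
def omhcAssign {m : ℕ} (A : OMHCAlg m) (I : OMHCInstance) : ℕ → Fin m :=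
  fun j => A j (I.E.image (fun e => e ∩ Finset.Icc 1 j))

/-- Makespan of a coloring: `max_{e ∈ E} max_{i ∈ [m]} |e ∩ φ⁻¹(i)|`. -/
def omhcMakespan (m : ℕ) (I : OMHCInstance) (φ : ℕ → Fin m) : ℕ :=
  I.E.sup (fun e => Finset.univ.sup (fun i : Fin m => (e.filter (fun v => φ v = i)).card))

/-- Offline optimum of an `OMHC(m)` instance: the minimum makespan over all colorings. -/
noncomputable def omhcOPT (m : ℕ) (I : OMHCInstance) : ℕ :=
  sInf {v | ∃ φ : ℕ → Fin m, v = omhcMakespan m I φ}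

/-- A hyperforest is a hypergraph without a hypercycle, i.e. without a cyclic sequence
`v_1, e_1, v_2, …, e_ℓ, v_{ℓ+1} = v_1` of pairwise distinct hyperedges `e_t` with
`v_t, v_{t+1} ∈ e_t` (consecutive nodes being distinct). -/
def IsHyperforest (E : Finset (Finset ℕ)) : Prop :=
  ¬ ∃ (l : ℕ) (v : ℕ → ℕ) (e : ℕ → Finset ℕ),
      1 ≤ l ∧
      (∀ t < l, e t ∈ E) ∧
      (∀ s < l, ∀ t < l, s ≠ t → e s ≠ e t) ∧
      (∀ t < l, v t ∈ e t ∧ v ((t + 1) % l) ∈ e t ∧ v t ≠ v ((t + 1) % l))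

/-- The recursion `X(m,d)` from Lemma 4.1: `X(m,d) = 1` if `m = 1` or `d = 1`, and
`X(m,d) = X(m-1,d)·((m-1)·X(m,d-1) + 1) + X(m,d-1)` otherwise. -/
def Xrec : ℕ → ℕ → ℕ
  | 0, _ => 1
  | _, 0 => 1
  | 1, _ => 1
  | _, 1 => 1
  | m + 2, d + 2 =>
      Xrec (m + 1) (d + 2) * ((m + 1) * Xrec (m + 2) (d + 1) + 1) + Xrec (m + 2) (d + 1)
  termination_by m d => (m, d)

/-- In every subfamily of edges, the edges span as many nodes as a forest would: a count that
characterizes hyperforests. -/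
def IsSparse (E : Finset (Finset ℕ)) : Prop :=
  ∀ F ⊆ E, ∑ e ∈ F, (e.card - 1) ≤ (F.sup id).card - 1

/-- A sparse family in which the edges of `M` lie in distinct components. -/
def IsSparseWith (E M : Finset (Finset ℕ)) : Prop :=
  ∀ F ⊆ E, ∑ e ∈ F, (e.card - 1) + (F ∩ M).card ≤ (F.sup id).card

theorem IsSparse.isHyperforest {E : Finset (Finset ℕ)} (hE : IsSparse E) : IsHyperforest E := by
  rintro ⟨l, v, e, hl, heE, hinj, hv⟩
  obtain rfl | hl2 : l = 1 ∨ 2 ≤ l := by omega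
  · exact (hv 0 one_pos).2.2 rfl
  have key : ∀ k, k + 1 < l →
      ((range (k + 1)).sup e).card ≤ ∑ t ∈ range (k + 1), ((e t).card - 1) + 1 := by
    intro k
    induction k with
    | zero => intro _; simp; omega
    | succ k ih =>
      intro hk
      have h1 := ih (by omega)
      rw [sum_range_succ, range_add_one, sup_insert]
      have hmem : v (k + 1) ∈ e (k + 1) ∩ (range (k + 1)).sup e := by
        have h2 := (hv k (by omega)).2.1
        rw [Nat.mod_eq_of_lt (by omega)] at h2
        exact mem_inter.2 ⟨(hv (k + 1) (by omega)).1,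
          (le_sup (f := e) (self_mem_range_succ k)) h2⟩
      have h3 := card_pos.2 ⟨_, hmem⟩
      have h4 := card_union_add_card_inter (e (k + 1)) ((range (k + 1)).sup e)
      rw [sup_eq_union]
      omega
  obtain ⟨k, rfl⟩ : ∃ k, l = k + 2 := ⟨l - 2, by omega⟩
  have h1 := key k (by omega)
  have hlast := hv (k + 1) (by omega)
  rw [Nat.mod_self] at hlast
  have hsub : {v (k + 1), v 0} ⊆ e (k + 1) ∩ (range (k + 1)).sup e := by
    intro x hx
    rw [mem_insert, mem_singleton] at hx
    obtain rfl | rfl := hx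
    · have h2 := (hv k (by omega)).2.1
      rw [Nat.mod_eq_of_lt (by omega)] at h2
      exact mem_inter.2 ⟨hlast.1, (le_sup (f := e) (self_mem_range_succ k)) h2⟩
    · exact mem_inter.2 ⟨hlast.2.1,
        (le_sup (f := e) (mem_range.2 k.succ_pos)) (hv 0 (by omega)).1⟩
  have h3 := card_le_card hsub
  rw [card_pair hlast.2.2] at h3
  have h4 := card_union_add_card_inter (e (k + 1)) ((range (k + 1)).sup e)
  have h5 := hE ((range (k + 2)).image e) (by
    intro x hx
    obtain ⟨t, ht, rfl⟩ := mem_image.1 hx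
    exact heE t (mem_range.1 ht))
  rw [sum_image (fun s hs t ht hst => by
    by_contra hne
    exact hinj s (by simpa using hs) t (by simpa using ht) hne hst), sup_image, Function.id_comp,
    sum_range_succ, range_add_one (n := k + 1), sup_insert, sup_eq_union] at h5
  have h6 := card_le_card (inter_subset_left (s₁ := e (k + 1)) (s₂ := (range (k + 1)).sup e))
  have h7 := card_le_card (subset_union_left (s₁ := e (k + 1)) (s₂ := (range (k + 1)).sup e))
  omega

theorem isSparse_of_card_le_one {E : Finset (Finset ℕ)} (h : ∀ e ∈ E, e.card ≤ 1) :
    IsSparse E := by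
  intro F hF
  rw [sum_eq_zero fun e he => Nat.sub_eq_zero_of_le (h e (hF he))]
  exact Nat.zero_le _

theorem IsSparse.isSparseWith_empty {E : Finset (Finset ℕ)} (hE : IsSparse E) :
    IsSparseWith E ∅ := fun F hF => by
  simpa using (hE F hF).trans (Nat.sub_le _ _)

theorem IsSparse.isSparseWith_singleton {E : Finset (Finset ℕ)} (hE : IsSparse E)
    {e : Finset ℕ} (he : e.Nonempty) : IsSparseWith E {e} := by
  intro F hF
  have h := hE F hF
  by_cases heF : e ∈ F
  · have h1 : 1 ≤ (F.sup id).card :=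
      (card_pos.2 he).trans_le (card_le_card (le_sup (f := id) heF))
    rw [inter_singleton_of_mem heF, card_singleton]
    omega
  · rw [inter_singleton_of_notMem heF, card_empty]
    omega

theorem sum_union_le_add (F G : Finset (Finset ℕ)) (f : Finset ℕ → ℕ) :
    ∑ e ∈ F ∪ G, f e ≤ ∑ e ∈ F, f e + ∑ e ∈ G, f e := by
  rw [← sum_union_inter]
  exact Nat.le_add_right _ _

theorem exists_union_of_subset_union {F E G : Finset (Finset ℕ)} (h : F ⊆ E ∪ G) :
    ∃ F₁ ⊆ E, ∃ F₂ ⊆ G, F = F₁ ∪ F₂ :=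
  ⟨F ∩ E, inter_subset_right, F ∩ G, inter_subset_right, by
    rw [← inter_union_distrib_left, inter_eq_left.2 h]⟩

theorem IsSparseWith.union {E G M N : Finset (Finset ℕ)} {U : Finset ℕ}
    (hE : IsSparseWith E M) (hG : IsSparseWith G N) (hEU : ∀ e ∈ E, e ⊆ U)
    (hGU : ∀ e ∈ G, Disjoint e U) (hM : M ⊆ E) (hN : N ⊆ G) :
    IsSparseWith (E ∪ G) (M ∪ N) := by
  intro F hF
  have h1 := hE (F ∩ E) inter_subset_right
  have h2 := hG (F ∩ G) inter_subset_right
  have hFu : F = F ∩ E ∪ F ∩ G := by rw [← inter_union_distrib_left, inter_eq_left.2 hF]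
  have h3 := sum_union_le_add (F ∩ E) (F ∩ G) fun e => e.card - 1
  rw [← hFu] at h3
  have hsup : F.sup id = (F ∩ E).sup id ∪ (F ∩ G).sup id := by
    conv_lhs => rw [hFu]
    rw [sup_union, sup_eq_union]
  have hdisj : Disjoint ((F ∩ E).sup id) ((F ∩ G).sup id) := by
    have hU : (F ∩ E).sup id ⊆ U := Finset.sup_le fun e he => hEU e (mem_inter.1 he).2
    exact Disjoint.mono_left hU
      (Finset.disjoint_sup_right.2 fun e he => (hGU e (mem_inter.1 he).2).symm)
  rw [hsup, card_union_of_disjoint hdisj]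
  have h4 : F ∩ (M ∪ N) = F ∩ E ∩ M ∪ F ∩ G ∩ N := by
    rw [inter_union_distrib_left, inter_assoc, inter_assoc, inter_eq_right.2 hM,
      inter_eq_right.2 hN]
  have h5 := card_union_le (F ∩ E ∩ M) (F ∩ G ∩ N)
  rw [h4]
  omega

/-- Attaching components to a sparse family `G` by adding to some edges of `M` one outside node
each keeps it sparse. -/
theorem IsSparse.image_union {E G M : Finset (Finset ℕ)} {U : Finset ℕ}
    {g : Finset ℕ → Finset ℕ} (hE : IsSparse E) (hEM : IsSparseWith E M) (hG : IsSparse G)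
    (hEU : ∀ e ∈ E, e ⊆ U) (hGU : ∀ e ∈ G, Disjoint e U) (hM : ∀ e ∈ M, e.Nonempty)
    (hg : ∀ e, (g e).card ≤ 1) (hgM : ∀ e, e ∉ M → g e = ∅) (hgU : ∀ e, Disjoint (g e) U) :
    IsSparse (E.image (fun e => e ∪ g e) ∪ G) := by
  intro F hF
  obtain ⟨F', hF', F₂, hF₂, rfl⟩ := exists_union_of_subset_union hF
  obtain ⟨F₁, hF₁, rfl⟩ := subset_image_iff.1 hF'
  have hF₁ : F₁ ⊆ E := hF₁
  have h1 : ∑ e ∈ F₁.image (fun e => e ∪ g e), (e.card - 1) ≤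
      ∑ e ∈ F₁, (e.card - 1) + (F₁.filter fun e => g e ≠ ∅).card := by
    rw [card_filter, ← sum_add_distrib]
    refine (sum_image_le_of_nonneg (fun _ _ => Nat.zero_le _)).trans (sum_le_sum fun e _ => ?_)
    by_cases hge : g e = ∅
    · simp [hge]
    · have heM : e ∈ M := by
        by_contra h
        exact hge (hgM e h)
      have := card_pos.2 (hM e heM)
      have := hg e
      have := card_union_le e (g e)
      simp only [ne_eq, hge, not_false_eq_true, if_true]
      omega
  have h2 := sum_union_le_add (F₁.image fun e => e ∪ g e) F₂ fun e => e.card - 1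
  have h3 := hG F₂ hF₂
  have hdisj : Disjoint (F₁.sup id) (F₂.sup id ∪ F₁.sup g) := by
    have hU : F₁.sup id ⊆ U := Finset.sup_le fun e he => hEU e (hF₁ he)
    refine Disjoint.mono_left hU (disjoint_union_right.2 ⟨?_, ?_⟩)
    · exact Finset.disjoint_sup_right.2 fun e he => (hGU e (hF₂ he)).symm
    · exact Finset.disjoint_sup_right.2 fun e _ => (hgU e).symm
  have hsup : (F₁.image (fun e => e ∪ g e) ∪ F₂).sup id =
      F₁.sup id ∪ (F₂.sup id ∪ F₁.sup g) := by
    have : F₁.sup (fun e => e ∪ g e) = F₁.sup id ∪ F₁.sup g := Finset.sup_sup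
    rw [sup_union, sup_image, Function.id_comp, this, sup_eq_union, union_assoc,
      union_comm (F₁.sup g)]
  rw [hsup, card_union_of_disjoint hdisj]
  have h4 := card_le_card (subset_union_left (s₁ := F₂.sup id) (s₂ := F₁.sup g))
  obtain hempty | ⟨e, he⟩ := (F₁.filter fun e => g e ≠ ∅).eq_empty_or_nonempty
  · rw [hempty, card_empty] at h1
    have h5 := hE F₁ hF₁
    omega
  · have h5 := hEM F₁ hF₁
    have h6 : (F₁.filter fun e => g e ≠ ∅).card ≤ (F₁ ∩ M).card := by
      refine card_le_card fun e he => ?_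
      rw [mem_filter] at he
      refine mem_inter.2 ⟨he.1, ?_⟩
      by_contra h
      exact he.2 (hgM e h)
    rw [mem_filter] at he
    have h7 : 1 ≤ (F₂.sup id ∪ F₁.sup g).card :=
      card_pos.2 (((nonempty_iff_ne_empty.2 he.2).mono (le_sup (f := g) he.1)).mono
        subset_union_right)
    omega

/-- The color that the online algorithm `A` gives to node `j` of a hypergraph with edge set `E`. -/
def onlineColor {C : Type*} (A : ℕ → Finset (Finset ℕ) → C) (E : Finset (Finset ℕ)) (j : ℕ) : C :=
  A j (E.image fun e => e ∩ Icc 1 j)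

/-- A hyperforest on the nodes `(a, b]`. The empty edge is included so that edges which start
later stay invisible to an online algorithm. -/
structure IsBoard (a b : ℕ) (E : Finset (Finset ℕ)) : Prop where
  le : a ≤ b
  empty_mem : ∅ ∈ E
  subset_Ioc : ∀ e ∈ E, e ⊆ Ioc a b
  isSparse : IsSparse E

/-- The coloring uses all colors of `S` or a color outside `S`. -/
def Exhausts {C : Type*} (A : ℕ → Finset (Finset ℕ) → C) (S : Finset C) (a b : ℕ)
    (E : Finset (Finset ℕ)) : Prop :=
  (∀ c ∈ S, ∃ j ∈ Ioc a b, onlineColor A E j = c) ∨ ∃ j ∈ Ioc a b, onlineColor A E j ∉ S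

/-- The edge `e` has size `d` and is monochromatic. -/
def IsMono {C : Type*} (A : ℕ → Finset (Finset ℕ) → C) (E : Finset (Finset ℕ)) (d : ℕ)
    (e : Finset ℕ) : Prop :=
  e.card = d ∧ ∃ c, ∀ v ∈ e, onlineColor A E v = c

/-- With `N` fresh nodes, every online algorithm is forced to exhaust `S` or to produce a
monochromatic edge of size `d`. -/
def CanForce {C : Type*} (S : Finset C) (d N : ℕ) : Prop :=
  ∀ (A : ℕ → Finset (Finset ℕ) → C) (a : ℕ), ∃ b E, IsBoard a b E ∧ b ≤ a + N ∧
    (Exhausts A S a b E ∨ ∃ e ∈ E, IsMono A E d e)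

/-- Each edge `e` of `E` together with the nodes of `g e` up to `n`. -/
def extendEdges (E : Finset (Finset ℕ)) (g : Finset ℕ → Finset ℕ) (n : ℕ) : Finset (Finset ℕ) :=
  E.image fun e => e ∪ (g e ∩ Icc 1 n)

theorem extendEdges_empty (E : Finset (Finset ℕ)) (n : ℕ) : extendEdges E (fun _ => ∅) n = E := by
  simp [extendEdges]

section ExtendEdges

variable {C : Type*} {A : ℕ → Finset (Finset ℕ) → C} {a b b' j : ℕ} {E G M : Finset (Finset ℕ)}
  {g : Finset ℕ → Finset ℕ}

/-- The algorithm that `A` induces on the nodes after `E`, whose edges are extended by `g`. -/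
def residualAlg (A : ℕ → Finset (Finset ℕ) → C) (E : Finset (Finset ℕ)) (g : Finset ℕ → Finset ℕ) :
    ℕ → Finset (Finset ℕ) → C :=
  fun j F => A j (extendEdges E g j ∪ F)

theorem onlineColor_extendEdges_left (hE : IsBoard a b E) (hG : IsBoard b b' G)
    (hg : ∀ e, ∀ v ∈ g e, b < v) (hj : j ≤ b) :
    onlineColor A (extendEdges E g b' ∪ G) j = onlineColor A E j := by
  unfold onlineColor
  congr 1
  have h1 : ∀ e, (e ∪ (g e ∩ Icc 1 b')) ∩ Icc 1 j = e ∩ Icc 1 j := fun e => by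
    ext v
    have := hg e v
    simp only [mem_inter, mem_union, mem_Icc]
    grind
  have h2 : G.image (fun e => e ∩ Icc 1 j) ⊆ E.image fun e => e ∩ Icc 1 j := by
    intro x hx
    obtain ⟨e, he, rfl⟩ := mem_image.1 hx
    refine mem_image.2 ⟨∅, hE.empty_mem, ?_⟩
    ext v
    have := fun hv => mem_Ioc.1 (hG.subset_Ioc e he hv : v ∈ _)
    simp only [mem_inter, mem_Icc, notMem_empty, false_and, false_iff]
    grind
  rw [image_union, extendEdges, image_image]
  simp only [Function.comp_def, h1]
  exact union_eq_left.2 h2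

theorem onlineColor_extendEdges_right (hE : IsBoard a b E) (hj : j ∈ Ioc b b') :
    onlineColor A (extendEdges E g b' ∪ G) j = onlineColor (residualAlg A E g) G j := by
  rw [mem_Ioc] at hj
  unfold onlineColor residualAlg
  congr 1
  rw [image_union, extendEdges, image_image]
  congr 1
  refine image_congr fun e he => ?_
  ext v
  have := fun hv => mem_Ioc.1 (hE.subset_Ioc e he hv : v ∈ _)
  simp only [Function.comp_apply, mem_inter, mem_union, mem_Icc]
  grind

theorem IsBoard.extendEdges_union (hE : IsBoard a b E) (hG : IsBoard b b' G) (hEM : IsSparseWith E M)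
    (hM : ∀ e ∈ M, e.Nonempty) (hg : ∀ e, ∀ v ∈ g e, b < v) (hg1 : ∀ e, (g e).card ≤ 1)
    (hgM : ∀ e, e ∉ M → g e = ∅) : IsBoard a b' (extendEdges E g b' ∪ G) where
  le := hE.le.trans hG.le
  empty_mem := mem_union_right _ hG.empty_mem
  subset_Ioc := by
    have h1 := hE.le
    have h2 := hG.le
    intro e he v hv
    rw [mem_Ioc]
    obtain he | he := mem_union.1 he
    · obtain ⟨e', he', rfl⟩ := mem_image.1 he
      obtain hv | hv := mem_union.1 hv
      · have := mem_Ioc.1 (hE.subset_Ioc e' he' hv)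
        omega
      · have := hg e' v (mem_inter.1 hv).1
        have := mem_Icc.1 (mem_inter.1 hv).2
        omega
    · have := mem_Ioc.1 (hG.subset_Ioc e he hv)
      omega
  isSparse := by
    refine hE.isSparse.image_union (U := Ioc a b) hEM hG.isSparse hE.subset_Ioc ?_ hM
      (fun e => (card_le_card inter_subset_left).trans (hg1 e))
      (fun e he => by rw [hgM e he, empty_inter]) ?_
    · refine fun e he => Finset.disjoint_left.2 fun v hv hv' => ?_
      have := mem_Ioc.1 (hG.subset_Ioc e he hv)
      have := mem_Ioc.1 hv'
      omega
    · refine fun e => Finset.disjoint_left.2 fun v hv hv' => ?_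
      have := hg e v (mem_inter.1 hv).1
      have := mem_Ioc.1 hv'
      omega

theorem Exhausts.extendEdges_left {S : Finset C} (h : Exhausts A S a b E) (hE : IsBoard a b E)
    (hG : IsBoard b b' G) (hg : ∀ e, ∀ v ∈ g e, b < v) :
    Exhausts A S a b' (extendEdges E g b' ∪ G) := by
  have hsub : Ioc a b ⊆ Ioc a b' := Ioc_subset_Ioc_right hG.le
  have hcol : ∀ j ∈ Ioc a b, onlineColor A (extendEdges E g b' ∪ G) j = onlineColor A E j :=
    fun j hj => onlineColor_extendEdges_left hE hG hg (mem_Ioc.1 hj).2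
  refine h.imp (fun h c hc => ?_) fun ⟨j, hj, hjS⟩ => ⟨j, hsub hj, by rwa [hcol j hj]⟩
  obtain ⟨j, hj, rfl⟩ := h c hc
  exact ⟨j, hsub hj, hcol j hj⟩

theorem Exhausts.extendEdges_right {S : Finset C} (h : Exhausts (residualAlg A E g) S b b' G)
    (hE : IsBoard a b E) : Exhausts A S a b' (extendEdges E g b' ∪ G) := by
  have hsub : Ioc b b' ⊆ Ioc a b' := Ioc_subset_Ioc_left hE.le
  refine h.imp (fun h c hc => ?_) fun ⟨j, hj, hjS⟩ =>
    ⟨j, hsub hj, by rwa [onlineColor_extendEdges_right hE hj]⟩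
  obtain ⟨j, hj, rfl⟩ := h c hc
  exact ⟨j, hsub hj, onlineColor_extendEdges_right hE hj⟩

theorem IsMono.extendEdges_left {d : ℕ} {e : Finset ℕ} (h : IsMono A E d e) (he : e ∈ E)
    (hE : IsBoard a b E) (hG : IsBoard b b' G) (hg : ∀ e, ∀ v ∈ g e, b < v) :
    IsMono A (extendEdges E g b' ∪ G) d e := by
  obtain ⟨hd, c, hc⟩ := h
  refine ⟨hd, c, fun v hv => ?_⟩
  rw [onlineColor_extendEdges_left hE hG hg (mem_Ioc.1 (hE.subset_Ioc e he hv)).2, hc v hv]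

theorem IsMono.extendEdges_right {d : ℕ} {e : Finset ℕ} (h : IsMono (residualAlg A E g) G d e)
    (he : e ∈ G) (hE : IsBoard a b E) (hG : IsBoard b b' G) :
    IsMono A (extendEdges E g b' ∪ G) d e := by
  obtain ⟨hd, c, hc⟩ := h
  refine ⟨hd, c, fun v hv => ?_⟩
  rw [onlineColor_extendEdges_right hE (hG.subset_Ioc e he hv), hc v hv]

end ExtendEdges

/-- Repeating a forcing strategy yields many monochromatic edges in distinct components. -/
theorem CanForce.exists_many {C : Type*} {S : Finset C} {d Z : ℕ} (h : CanForce S d Z)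
    (hd : 1 ≤ d) (A : ℕ → Finset (Finset ℕ) → C) (a k : ℕ) :
    ∃ b E, IsBoard a b E ∧ b ≤ a + k * Z ∧ (Exhausts A S a b E ∨
      ∃ M ⊆ E, M.card = k ∧ IsSparseWith E M ∧ ∀ e ∈ M, IsMono A E d e) := by
  induction k with
  | zero =>
    have hs : IsSparse {∅} := isSparse_of_card_le_one (by simp)
    exact ⟨a, {∅}, ⟨le_rfl, by simp, by simp, hs⟩, by simp, Or.inr ⟨∅, by simp, by simp,
      hs.isSparseWith_empty, by simp⟩⟩
  | succ k ih =>
    obtain ⟨b, E, hE, hb, hout⟩ := ih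
    obtain hex | ⟨M, hME, hMk, hEM, hM⟩ := hout
    · exact ⟨b, E, hE, hb.trans (by gcongr; omega), Or.inl hex⟩
    obtain ⟨b', G, hG, hb', hout⟩ := h (residualAlg A E fun _ => ∅) b
    have hboard : IsBoard a b' (extendEdges E (fun _ => ∅) b' ∪ G) :=
      hE.extendEdges_union hG hE.isSparse.isSparseWith_empty (by simp) (by simp) (by simp) (by simp)
    refine ⟨b', extendEdges E (fun _ => ∅) b' ∪ G, hboard, by rw [add_one_mul]; omega, ?_⟩
    obtain hex | ⟨e, heG, he⟩ := hout
    · exact Or.inl (hex.extendEdges_right hE)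
    have hne : e.Nonempty := card_pos.1 (by rw [he.1]; exact hd)
    have hdisj : ∀ e ∈ G, Disjoint e (Ioc a b) := fun e he =>
      Finset.disjoint_left.2 fun v hv hv' => by
        have := mem_Ioc.1 (hG.subset_Ioc e he hv)
        have := mem_Ioc.1 hv'
        omega
    refine Or.inr ⟨M ∪ {e}, ?_, ?_, ?_, ?_⟩
    · rw [extendEdges_empty]
      exact union_subset_union hME (singleton_subset_iff.2 heG)
    · rw [card_union_of_disjoint, hMk, card_singleton]
      refine Finset.disjoint_singleton_right.2 fun heM => ?_
      obtain ⟨v, hv⟩ := hne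
      exact Finset.disjoint_left.1 (hdisj e heG) hv (hE.subset_Ioc e (hME heM) hv)
    · rw [extendEdges_empty]
      exact hEM.union (hG.isSparse.isSparseWith_singleton hne) hE.subset_Ioc hdisj hME
        (singleton_subset_iff.2 heG)
    · intro x hx
      obtain hx | hx := mem_union.1 hx
      · exact (hM x hx).extendEdges_left (hME hx) hE hG (by simp)
      · rw [mem_singleton.1 hx]
        exact he.extendEdges_right heG hE hG

theorem CanForce.step {C : Type*} [DecidableEq C] {S : Finset C} {d Y Z : ℕ} (hd : 1 ≤ d)
    (hZ : CanForce S d Z) (hY : ∀ c ∈ S, CanForce (S.erase c) (d + 1) Y) :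
    CanForce S (d + 1) (Y * ((S.card - 1) * Z + 1) + Z) := by
  intro A a
  obtain ⟨b, E, hE, hb, hout⟩ := hZ.exists_many hd A a ((S.card - 1) * Y + 1)
  have hbound : b + Y ≤ a + (Y * ((S.card - 1) * Z + 1) + Z) := by
    calc b + Y ≤ a + ((S.card - 1) * Y + 1) * Z + Y := by omega
      _ = _ := by ring
  by_cases hex : Exhausts A S a b E
  · exact ⟨b, E, hE, by omega, Or.inl hex⟩
  obtain ⟨M, hME, hMk, hEM, hM⟩ := hout.resolve_left hex
  have hMne : ∀ e ∈ M, e.Nonempty := fun e he => card_pos.1 (by rw [(hM e he).1]; exact hd)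
  simp only [Exhausts, not_or, not_forall, not_exists, not_and, not_not] at hex
  obtain ⟨⟨c₀, hc₀S, hc₀⟩, hcolS⟩ := hex
  have : Nonempty C := ⟨c₀⟩
  choose! κ hκ using fun e he => (hM e he).2
  have hκS : ∀ e ∈ M, κ e ∈ S.erase c₀ := by
    intro e he
    obtain ⟨v, hv⟩ := hMne e he
    have hv' := hE.subset_Ioc e (hME he) hv
    rw [← hκ e he v hv]
    exact mem_erase.2 ⟨hc₀ v hv', hcolS v hv'⟩
  obtain ⟨c, hcS, hc⟩ := exists_lt_card_fiber_of_mul_lt_card_of_maps_to (n := Y) hκS (by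
    rw [hMk, card_erase_of_mem hc₀S]; omega)
  replace hcS := (mem_erase.1 hcS).2
  have hcard : ((Ioc b (b + Y) : Finset ℕ) : Set ℕ).encard ≤
      ((M.filter fun e => κ e = c : Finset (Finset ℕ)) : Set (Finset ℕ)).encard := by
    rw [Set.encard_coe_eq_coe_finsetCard, Set.encard_coe_eq_coe_finsetCard, Nat.card_Ioc]
    exact_mod_cast (by omega)
  obtain ⟨f, hfM, hf⟩ := (finite_toSet _).exists_injOn_of_encard_le hcard
  replace hfM : ∀ v ∈ Ioc b (b + Y), f v ∈ M ∧ κ (f v) = c := fun v hv =>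
    mem_filter.1 (mem_coe.1 (hfM (mem_coe.2 hv)))
  let g : Finset ℕ → Finset ℕ := fun e => (Ioc b (b + Y)).filter fun v => f v = e
  have hg : ∀ e, ∀ v ∈ g e, b < v := fun e v hv => (mem_Ioc.1 (mem_filter.1 hv).1).1
  have hg1 : ∀ e, (g e).card ≤ 1 := fun e => card_le_one.2 fun v hv w hw => by
    rw [mem_filter] at hv hw
    exact hf (mem_coe.2 hv.1) (mem_coe.2 hw.1) (hv.2.trans hw.2.symm)
  have hgM : ∀ e, e ∉ M → g e = ∅ := fun e he => filter_eq_empty_iff.2 fun v hv hve =>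
    he (hve ▸ (hfM v hv).1)
  obtain ⟨b', G, hG, hb', hout⟩ := hY c hcS (residualAlg A E g) b
  refine ⟨b', extendEdges E g b' ∪ G, hE.extendEdges_union hG hEM hMne hg hg1 hgM, by omega, ?_⟩
  obtain hex | ⟨e, heG, he⟩ := hout
  swap
  · exact Or.inr ⟨e, mem_union_right _ heG, he.extendEdges_right heG hE hG⟩
  have hleft : ∀ e ∈ M, ∀ v ∈ e, onlineColor A (extendEdges E g b' ∪ G) v = κ e := by
    intro e he v hv
    rw [onlineColor_extendEdges_left hE hG hg (mem_Ioc.1 (hE.subset_Ioc e (hME he) hv)).2,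
      hκ e he v hv]
  obtain hall | ⟨j, hj, hjS⟩ := hex
  · refine Or.inl (Or.inl fun i hi => ?_)
    by_cases hic : i = c
    · obtain ⟨e, he⟩ := card_pos.1 (Nat.zero_lt_of_lt hc)
      rw [mem_filter] at he
      obtain ⟨v, hv⟩ := hMne e he.1
      exact ⟨v, Ioc_subset_Ioc_right hG.le (hE.subset_Ioc e (hME he.1) hv), by
        rw [hleft e he.1 v hv, he.2, hic]⟩
    · obtain ⟨j, hj, hji⟩ := hall i (mem_erase.2 ⟨hic, hi⟩)
      exact ⟨j, Ioc_subset_Ioc_left hE.le hj, by rw [onlineColor_extendEdges_right hE hj, hji]⟩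
  rw [← onlineColor_extendEdges_right hE hj] at hjS
  by_cases hjS' : onlineColor A (extendEdges E g b' ∪ G) j ∈ S
  swap
  · exact Or.inl (Or.inr ⟨j, Ioc_subset_Ioc_left hE.le hj, hjS'⟩)
  have hjc : onlineColor A (extendEdges E g b' ∪ G) j = c := by
    by_contra h
    exact hjS (mem_erase.2 ⟨h, hjS'⟩)
  rw [mem_Ioc] at hj
  have hjY : j ∈ Ioc b (b + Y) := mem_Ioc.2 ⟨hj.1, by omega⟩
  obtain ⟨hjM, hjκ⟩ := hfM j hjY
  have hgj : g (f j) ∩ Icc 1 b' = {j} := by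
    have hmem : j ∈ g (f j) := mem_filter.2 ⟨hjY, rfl⟩
    rw [eq_singleton_iff_unique_mem]
    exact ⟨mem_inter.2 ⟨hmem, mem_Icc.2 ⟨by omega, hj.2⟩⟩, fun v hv =>
      card_le_one.1 (hg1 _) v (mem_inter.1 hv).1 j hmem⟩
  refine Or.inr ⟨f j ∪ {j}, mem_union_left _ (mem_image.2 ⟨f j, hME hjM, by rw [hgj]⟩), ?_, c, ?_⟩
  · rw [card_union_of_disjoint, (hM _ hjM).1, card_singleton]
    refine Finset.disjoint_singleton_right.2 fun h => ?_
    have := mem_Ioc.1 (hE.subset_Ioc _ (hME hjM) h)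
    omega
  · intro v hv
    obtain hv | hv := mem_union.1 hv
    · rw [hleft _ hjM v hv, hjκ]
    · rw [mem_singleton.1 hv, hjc]

theorem canForce_Xrec {C : Type*} [DecidableEq C] (m d : ℕ) (S : Finset C)
    (hS : S.card = m + 1) : CanForce S (d + 1) (Xrec (m + 1) (d + 1)) := by
  induction m generalizing d S with
  | zero =>
    obtain ⟨c, rfl⟩ := card_eq_one.1 hS
    intro A a
    have hX : Xrec (0 + 1) (d + 1) = 1 := by simp [Xrec]
    refine ⟨a + 1, {∅}, ⟨by omega, by simp, by simp, isSparse_of_card_le_one (by simp)⟩,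
      by rw [hX], Or.inl ?_⟩
    by_cases h : onlineColor A {∅} (a + 1) = c
    · exact Or.inl fun i hi => ⟨a + 1, by simp, by rw [h, mem_singleton.1 hi]⟩
    · exact Or.inr ⟨a + 1, by simp, by simpa using h⟩
  | succ m ihm =>
    induction d with
    | zero =>
      intro A a
      have hX : Xrec (m + 1 + 1) (0 + 1) = 1 := by simp [Xrec]
      exact ⟨a + 1, {∅, {a + 1}}, ⟨by omega, by simp, by simp,
        isSparse_of_card_le_one (by simp)⟩, by rw [hX],
        Or.inr ⟨{a + 1}, by simp, by simp, onlineColor A {∅, {a + 1}} (a + 1), by simp⟩⟩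
    | succ d ihd =>
      have hX : Xrec (m + 1 + 1) (d + 1 + 1) = Xrec (m + 1) (d + 2) *
          ((S.card - 1) * Xrec (m + 2) (d + 1) + 1) + Xrec (m + 2) (d + 1) := by
        rw [Xrec, hS]
        rfl
      rw [hX]
      exact ihd.step (by omega) fun c hc => ihm (d + 1) _ (by rw [card_erase_of_mem hc, hS]; rfl)

/-- **Lemma.** For all `m, d ≥ 1`, every deterministic online algorithm for `OMHC(m)` admits
a hyperforest instance with at most `X(m,d)` nodes on which its coloring either uses every
color, or makes some hyperedge of size `d` monochromatic. -/
theorem omhc_all_colors_or_mono_edge (m d : ℕ) (hm : 1 ≤ m) (hd : 1 ≤ d) (A : OMHCAlg m) :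
    ∃ I : OMHCInstance, IsHyperforest I.E ∧ I.n ≤ Xrec m d ∧
      ((∀ i : Fin m, ∃ j, 1 ≤ j ∧ j ≤ I.n ∧ omhcAssign A I j = i) ∨
        ∃ e ∈ I.E, e.card = d ∧ ∀ v ∈ e, ∀ w ∈ e, omhcAssign A I v = omhcAssign A I w) := by
  obtain ⟨m, rfl⟩ : ∃ k, m = k + 1 := ⟨m - 1, by omega⟩
  obtain ⟨d, rfl⟩ : ∃ k, d = k + 1 := ⟨d - 1, by omega⟩
  obtain ⟨b, E, hE, hb, hout⟩ := canForce_Xrec m d (univ : Finset (Fin (m + 1))) (by simp) A 0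
  refine ⟨⟨b, E, hE.subset_Ioc⟩, hE.isSparse.isHyperforest, by simpa using hb, ?_⟩
  obtain (hall | ⟨j, -, hj⟩) | ⟨e, he, hed, c, hc⟩ := hout
  · refine Or.inl fun i => ?_
    obtain ⟨j, hj, hji⟩ := hall i (mem_univ i)
    exact ⟨j, (mem_Ioc.1 hj).1, (mem_Ioc.1 hj).2, hji⟩
  · exact absurd (mem_univ _) hj
  · exact Or.inr ⟨e, he, hed, fun v hv w hw => (hc v hv).trans (hc w hw).symm⟩
end
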